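/- Let g > 0, α ∈ (0,1), and α_n = min{1, g/n^α}. Then lim_{n→∞} E[K_n]/n^α = 1/g. -/

import Mathlib

open Finset Filter

/-- The law of the snapshot chain `K_n` with reset probabilities `a`:
`p n k = P[K_n = k]`, with `K_1 = 1` a.s., support `{1,…,n}`,
`P[K_{n+1} = 1] = a (n+1)` and `P[K_{n+1} = k+1] = (1 - a (n+1)) * P[K_n = k]`. -/
def IsSnapshotLaw (a : ℕ → ℝ) (p : ℕ → ℕ → ℝ) : Prop :=
  p 1 1 = 1 ∧
  (∀ n k, 1 ≤ n → (k = 0 ∨ n < k) → p n k = 0) ∧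
  (∀ n, 1 ≤ n → p (n + 1) 1 = a (n + 1)) ∧
  (∀ n k, 1 ≤ n → 1 ≤ k → k ≤ n → p (n + 1) (k + 1) = (1 - a (n + 1)) * p n k)

/-- `E[K_n]` for the snapshot chain with law `p`. -/
noncomputable def snapExp (p : ℕ → ℕ → ℝ) (n : ℕ) : ℝ :=
  ∑ k ∈ Finset.Icc 1 n, (k : ℝ) * p n k

/-- A discrete Gronwall-type convergence criterion: a nonnegative sequence which is eventually
bounded by convex combinations of its previous value and a null sequence tends to zero, provided
the weights are not summable. -/
lemma tendsto_zero_of_le_convex_combination {u a e : ℕ → ℝ} (hu : ∀ n, 0 ≤ u n)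
    (ha0 : ∀ n, 0 ≤ a n) (ha1 : ∀ n, a n ≤ 1) (ha : ¬ Summable a)
    (he : Tendsto e atTop (nhds 0))
    (h : ∀ᶠ n in atTop, u (n + 1) ≤ (1 - a n) * u n + a n * e n) :
    Tendsto u atTop (nhds 0) := by
  rw [Metric.tendsto_atTop]
  intro ε hε
  obtain ⟨N, hN⟩ := eventually_atTop.1 (h.and (he.eventually_lt_const (half_pos hε)))
  have hbound : ∀ m, u (N + m) - ε / 2 ≤
      Real.exp (-∑ i ∈ range m, a (i + N)) * |u N - ε / 2| := by
    intro m
    induction m with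
    | zero => simpa using le_abs_self (u N - ε / 2)
    | succ m ih =>
      obtain ⟨h1, h2⟩ := hN (N + m) (by omega)
      have h3 : 0 ≤ 1 - a (N + m) := sub_nonneg.2 (ha1 _)
      have h4 : 1 - a (N + m) ≤ Real.exp (-a (N + m)) := Real.one_sub_le_exp_neg _
      have h5 : u (N + m + 1) - ε / 2 ≤ (1 - a (N + m)) * (u (N + m) - ε / 2) := by
        nlinarith [mul_le_mul_of_nonneg_left h2.le (ha0 (N + m))]
      rw [sum_range_succ, neg_add, Real.exp_add, add_comm m N]
      calc u (N + m + 1) - ε / 2 ≤ (1 - a (N + m)) * (u (N + m) - ε / 2) := h5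
        _ ≤ (1 - a (N + m)) * (Real.exp (-∑ i ∈ range m, a (i + N)) * |u N - ε / 2|) := by
          gcongr
        _ ≤ Real.exp (-a (N + m)) *
            (Real.exp (-∑ i ∈ range m, a (i + N)) * |u N - ε / 2|) := by gcongr
        _ = _ := by ring
  have hdiv : Tendsto (fun m => ∑ i ∈ range m, a (i + N)) atTop atTop :=
    (not_summable_iff_tendsto_nat_atTop_of_nonneg fun i => ha0 (i + N)).1
      (by rwa [summable_nat_add_iff N])
  have hlim : Tendsto (fun m => Real.exp (-∑ i ∈ range m, a (i + N)) * |u N - ε / 2|)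
      atTop (nhds 0) := by
    simpa using (Real.tendsto_exp_neg_atTop_nhds_zero.comp hdiv).mul_const |u N - ε / 2|
  obtain ⟨M, hM⟩ := eventually_atTop.1 (hlim.eventually_lt_const (half_pos hε))
  refine ⟨N + M, fun n hn => ?_⟩
  obtain ⟨m, rfl⟩ := Nat.exists_eq_add_of_le (show N ≤ n by omega)
  rw [Real.dist_eq, sub_zero, abs_of_nonneg (hu _)]
  linarith [hbound m, hM m (by omega)]

lemma Real.tendsto_rpow_succ_sub_rpow {s : ℝ} (hs0 : 0 ≤ s) (hs1 : s < 1) :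
    Tendsto (fun n : ℕ => ((n + 1 : ℕ) : ℝ) ^ s - (n : ℝ) ^ s) atTop (nhds 0) := by
  have hlim : Tendsto (fun n : ℕ => s * (n : ℝ) ^ (-(1 - s))) atTop (nhds 0) := by
    simpa using ((tendsto_rpow_neg_atTop (sub_pos.2 hs1)).comp
      tendsto_natCast_atTop_atTop).const_mul s
  refine tendsto_of_tendsto_of_tendsto_of_le_of_le' tendsto_const_nhds hlim ?_ ?_
  · refine Eventually.of_forall fun n => sub_nonneg.2 ?_
    gcongr
    omega
  · filter_upwards [eventually_ge_atTop 1] with n hn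
    have hn : (0 : ℝ) < n := by exact_mod_cast hn
    have h1 : ((n + 1 : ℕ) : ℝ) = n * (1 + 1 / n) := by
      push_cast
      field_simp
    have h2 : (1 + 1 / (n : ℝ)) ^ s ≤ 1 + s * (1 / n) :=
      rpow_one_add_le_one_add_mul_self
        (by have : 0 ≤ 1 / (n : ℝ) := by positivity
            linarith) hs0 hs1.le
    have h3 : (n : ℝ) ^ (-(1 - s)) = n ^ s * (1 / n) := by
      rw [neg_sub, Real.rpow_sub_one hn.ne', mul_one_div]
    rw [h1, Real.mul_rpow hn.le (by positivity), h3]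
    nlinarith [mul_le_mul_of_nonneg_left h2 (Real.rpow_nonneg hn.le s)]

namespace IsSnapshotLaw

variable {a : ℕ → ℝ} {p : ℕ → ℕ → ℝ}

lemma sum_Icc_succ (hp : IsSnapshotLaw a p) (f : ℕ → ℝ) {n : ℕ} (hn : 1 ≤ n) :
    ∑ k ∈ Icc 1 (n + 1), f k * p (n + 1) k =
      f 1 * a (n + 1) + (1 - a (n + 1)) * ∑ k ∈ Icc 1 n, f (k + 1) * p n k := by
  obtain ⟨-, -, h1, h2⟩ := hp
  have hshift : ∑ k ∈ Icc (1 + 1) (n + 1), f k * p (n + 1) k =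
      ∑ k ∈ Icc 1 n, f (k + 1) * p (n + 1) (k + 1) := by
    rw [← map_add_right_Icc, sum_map]
    rfl
  rw [← add_sum_Ioc_eq_sum_Icc (by omega : 1 ≤ n + 1), h1 n hn, mul_sum,
    ← Icc_add_one_left_eq_Ioc, hshift]
  congr 1
  refine sum_congr rfl fun k hk => ?_
  rw [mem_Icc] at hk
  rw [h2 n k hn hk.1 hk.2]
  ring

lemma sum_eq_one (hp : IsSnapshotLaw a p) {n : ℕ} (hn : 1 ≤ n) :
    ∑ k ∈ Icc 1 n, p n k = 1 := by
  induction n, hn using Nat.le_induction with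
  | base => simpa using hp.1
  | succ n hn ih =>
    have h := hp.sum_Icc_succ (fun _ => 1) hn
    simp only [one_mul, ih] at h
    rw [h]
    ring

lemma snapExp_succ (hp : IsSnapshotLaw a p) {n : ℕ} (hn : 1 ≤ n) :
    snapExp p (n + 1) = 1 + (1 - a (n + 1)) * snapExp p n := by
  have h := hp.sum_Icc_succ (fun k => (k : ℝ)) hn
  simp only [Nat.cast_add, Nat.cast_one, add_mul, one_mul, sum_add_distrib,
    hp.sum_eq_one hn] at h
  rw [snapExp, snapExp, h]
  ring

end IsSnapshotLaw


theorem snapshot_sublinear_expectation (g al : ℝ) (hg : 0 < g)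
    (hal : al ∈ Set.Ioo (0 : ℝ) 1) (a : ℕ → ℝ) (p : ℕ → ℕ → ℝ)
    (ha : ∀ n, a n = min 1 (g / (n : ℝ) ^ al))
    (hp : IsSnapshotLaw a p) :
    Tendsto (fun n : ℕ => snapExp p n / (n : ℝ) ^ al) atTop (nhds (1 / g)) := by
  obtain ⟨hal0, hal1⟩ := hal
  set b : ℕ → ℝ := fun n => (n : ℝ) ^ al
  have hb_top : Tendsto b atTop atTop :=
    (tendsto_rpow_atTop hal0).comp tendsto_natCast_atTop_atTop
  have hb_nonneg : ∀ n, 0 ≤ b n := fun n => by positivity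
  have ha_eq : ∀ᶠ n in atTop, a n = g / b n := by
    filter_upwards [hb_top.eventually_ge_atTop g] with n hn
    rw [ha n]
    exact min_eq_right (div_le_one_of_le₀ hn (hb_nonneg n))
  have ha0 : ∀ n, 0 ≤ a n := fun n => by
    rw [ha n]
    positivity
  have ha1 : ∀ n, a n ≤ 1 := fun n => by
    rw [ha n]
    exact min_le_left _ _
  have ha_sum : ¬ Summable a := by
    intro hs
    have h : Summable fun n => g * (b n)⁻¹ :=
      Summable.of_norm_bounded_eventually_nat hs (by
        filter_upwards [ha_eq] with n hn
        rw [hn, ← div_eq_mul_inv, Real.norm_of_nonneg (div_nonneg hg.le (hb_nonneg n))])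
    rw [summable_mul_left_iff hg.ne', Real.summable_nat_rpow_inv] at h
    linarith
  set d : ℕ → ℝ := fun n => (b (n + 1) - b n) * (1 / b (n + 1) - 1 / g) with hd
  have hd_lim : Tendsto d atTop (nhds 0) := by
    have h1 : Tendsto (fun n => 1 / b (n + 1) - 1 / g) atTop (nhds (0 - 1 / g)) := by
      exact (tendsto_const_nhds.div_atTop
        (hb_top.comp (tendsto_add_atTop_nat 1))).sub_const (1 / g)
    have h2 := (Real.tendsto_rpow_succ_sub_rpow hal0.le hal1).mul h1
    rwa [zero_mul] at h2
  have he_lim : Tendsto (fun n => |d n| / g) atTop (nhds 0) := by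
    simpa using hd_lim.abs.div_const g
  have key : Tendsto (fun n => |snapExp p n / b n - 1 / g|) atTop (nhds 0) := by
    refine tendsto_zero_of_le_convex_combination (a := fun n => a (n + 1))
      (fun _ => abs_nonneg _) (fun n => ha0 _) (fun n => ha1 _)
      (by rwa [summable_nat_add_iff 1]) he_lim ?_
    filter_upwards [(tendsto_add_atTop_nat 1).eventually ha_eq, eventually_ge_atTop 1]
      with n hn hn1
    have hb0 : 0 < b n := Real.rpow_pos_of_pos (by exact_mod_cast hn1) _
    have hb1 : 0 < b (n + 1) := Real.rpow_pos_of_pos (by positivity) _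
    have hmono : b n ≤ b (n + 1) :=
      Real.rpow_le_rpow (by positivity) (by exact_mod_cast n.le_succ) hal0.le
    have hrec : snapExp p (n + 1) / b (n + 1) - 1 / g =
        (1 - a (n + 1)) * (b n / b (n + 1) * (snapExp p n / b n - 1 / g)) +
          d n / b (n + 1) := by
      rw [hp.snapExp_succ hn1, hn]
      simp only [hd]
      field_simp
      ring
    have hterm : |d n / b (n + 1)| = a (n + 1) * (|d n| / g) := by
      rw [abs_div, abs_of_pos hb1, hn]
      field_simp
    have hratio : b n / b (n + 1) ≤ 1 := div_le_one_of_le₀ hmono hb1.le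
    rw [hrec, ← hterm]
    refine (abs_add_le _ _).trans (add_le_add_left ?_ _)
    rw [abs_mul, abs_mul, abs_of_nonneg (sub_nonneg.2 (ha1 _)),
      abs_of_nonneg (div_nonneg hb0.le hb1.le)]
    exact mul_le_mul_of_nonneg_left (mul_le_of_le_one_left (abs_nonneg _) hratio)
      (sub_nonneg.2 (ha1 _))
  rw [tendsto_iff_dist_tendsto_zero]
  simpa only [Real.dist_eq] using key
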